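/- arXiv:2106.12338 — 3 statements merged into one kernel-verified Lean document; each statement's English description precedes it below -/
import Mathlib

section
/- Let ω, μ, σ², τ, B, h be positive real numbers and set A = ω·B·h/(μ·σ²·ln 2). If A ≥ 1, then ℓ* = τ·B·log₂(A) is the unique maximizer over [0, ∞) of g(ℓ) = ω·ℓ − μ·(σ²·τ/h)·(2^{ℓ/(τ·B)} − 1): for every ℓ ≥ 0 with ℓ ≠ ℓ*, one has g(ℓ) < g(ℓ*). -/
/-- The exponential `x ↦ b ^ x` lies strictly above its tangent line at `logb b A`, away from the
point of tangency. -/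
theorem Real.tangent_at_logb_lt_rpow {b A x : ℝ} (hb : 0 < b) (hb1 : b ≠ 1) (hA : 0 < A)
    (hx : x ≠ Real.logb b A) :
    A + A * Real.log b * (x - Real.logb b A) < b ^ x := by
  have hlog : Real.log b ≠ 0 := Real.log_ne_zero_of_pos_of_ne_one hb hb1
  have hpow : b ^ x = A * Real.exp (Real.log b * (x - Real.logb b A)) := by
    rw [← Real.rpow_def_of_pos hb, Real.rpow_sub hb, Real.rpow_logb hb hb1 hA]
    field_simp
  have hexp := Real.add_one_lt_exp (mul_ne_zero hlog (sub_ne_zero.mpr hx))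
  rw [hpow]
  linarith [mul_lt_mul_of_pos_left hexp hA]

/-- Proposition 1(b): if `A = ω·B·h/(μ·σ²·ln 2) ≥ 1`, then
`ℓ* = τ·B·log₂(A)` is the unique maximizer over `[0, ∞)` of
`g(ℓ) = ω·ℓ − μ·(σ²·τ/h)·(2^{ℓ/(τ·B)} − 1)`. -/
theorem offload_objective_unique_maximizer
    (ω μ σ2 τ B h : ℝ) (hω : 0 < ω) (hμ : 0 < μ) (hσ : 0 < σ2)
    (hτ : 0 < τ) (hB : 0 < B) (hh : 0 < h)
    (hA : 1 ≤ ω * B * h / (μ * σ2 * Real.log 2)) :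
    ∀ ℓ : ℝ, 0 ≤ ℓ →
      ℓ ≠ τ * B * Real.logb 2 (ω * B * h / (μ * σ2 * Real.log 2)) →
      ω * ℓ - μ * (σ2 * τ / h) * ((2 : ℝ) ^ (ℓ / (τ * B)) - 1)
        < ω * (τ * B * Real.logb 2 (ω * B * h / (μ * σ2 * Real.log 2)))
          - μ * (σ2 * τ / h) *
            ((2 : ℝ) ^ (τ * B * Real.logb 2 (ω * B * h / (μ * σ2 * Real.log 2)) / (τ * B)) - 1) := by
  intro ℓ _ hne
  have hcoef : ω * (τ * B) =
      μ * (σ2 * τ / h) * (ω * B * h / (μ * σ2 * Real.log 2) * Real.log 2) := by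
    field_simp
  generalize ω * B * h / (μ * σ2 * Real.log 2) = A at *
  have hA0 : 0 < A := one_pos.trans_le hA
  have hτB : 0 < τ * B := mul_pos hτ hB
  have hc : 0 < μ * (σ2 * τ / h) := by positivity
  obtain ⟨x, rfl⟩ : ∃ x, ℓ = τ * B * x := ⟨ℓ / (τ * B), by field_simp⟩
  have hx : x ≠ Real.logb 2 A := fun hx => hne (by rw [hx])
  rw [mul_div_cancel_left₀ _ hτB.ne', mul_div_cancel_left₀ _ hτB.ne',
    Real.rpow_logb two_pos (by norm_num) hA0, ← mul_assoc ω (τ * B), ← mul_assoc ω (τ * B), hcoef]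
  have htangent := Real.tangent_at_logb_lt_rpow two_pos (by norm_num) hA0 hx
  linarith [mul_lt_mul_of_pos_left htangent hc]
end

section
/- Let ω, μ, σ², τ, B, h be positive real numbers, set A = ω·B·h/(μ·σ²·ln 2), and suppose A ≥ 1. Then the maximum value of g(ℓ) = ω·ℓ − μ·(σ²·τ/h)·(2^{ℓ/(τ·B)} − 1) over ℓ ≥ 0, attained at ℓ* = τ·B·log₂(A), equals ω·τ·B·(log₂(A) − (A − 1)/(A·ln 2)). -/
/-- The tangent line to `x ↦ 2 ^ x` at `x = logb 2 A` lies below the graph. -/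
theorem two_rpow_tangent_le {A : ℝ} (hA : 0 < A) (x : ℝ) :
    A * (1 + Real.log 2 * (x - Real.logb 2 A)) ≤ (2 : ℝ) ^ x := by
  have hL : Real.log 2 ≠ 0 := (Real.log_pos one_lt_two).ne'
  have hexp : (2 : ℝ) ^ x = A * Real.exp (Real.log 2 * (x - Real.logb 2 A)) := by
    have hlog : Real.log 2 * (x - Real.logb 2 A) = Real.log 2 * x - Real.log A := by
      rw [Real.logb]
      field_simp
    rw [hlog, Real.exp_sub, Real.exp_log hA, Real.rpow_def_of_pos two_pos]
    field_simp
  rw [hexp]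
  gcongr
  linarith [Real.add_one_le_exp (Real.log 2 * (x - Real.logb 2 A))]

/-- If `A = ω·B·h/(μ·σ²·ln 2) ≥ 1`, the maximum of
`g(ℓ) = ω·ℓ − μ·(σ²·τ/h)·(2^{ℓ/(τ·B)} − 1)` over `ℓ ≥ 0`, attained at
`ℓ* = τ·B·log₂ A`, equals `ω·τ·B·(log₂ A − (A − 1)/(A·ln 2))`. -/
theorem offload_objective_max_value
    (ω μ σ2 τ B h : ℝ) (hω : 0 < ω) (hμ : 0 < μ) (hσ : 0 < σ2)
    (hτ : 0 < τ) (hB : 0 < B) (hh : 0 < h)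
    (A : ℝ) (hAdef : A = ω * B * h / (μ * σ2 * Real.log 2)) (hA : 1 ≤ A) :
    (∀ ℓ : ℝ, 0 ≤ ℓ →
        ω * ℓ - μ * (σ2 * τ / h) * ((2 : ℝ) ^ (ℓ / (τ * B)) - 1)
          ≤ ω * (τ * B * Real.logb 2 A)
            - μ * (σ2 * τ / h) * ((2 : ℝ) ^ (τ * B * Real.logb 2 A / (τ * B)) - 1))
    ∧ ω * (τ * B * Real.logb 2 A)
        - μ * (σ2 * τ / h) * ((2 : ℝ) ^ (τ * B * Real.logb 2 A / (τ * B)) - 1)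
      = ω * τ * B * (Real.logb 2 A - (A - 1) / (A * Real.log 2)) := by
  have hL : 0 < Real.log 2 := Real.log_pos one_lt_two
  have hA0 : 0 < A := zero_lt_one.trans_le hA
  have hcoef : μ * (σ2 * τ / h) = ω * τ * B / (A * Real.log 2) := by
    rw [hAdef]
    field_simp
  have hopt : (2 : ℝ) ^ (τ * B * Real.logb 2 A / (τ * B)) = A := by
    rw [mul_div_cancel_left₀ _ (mul_pos hτ hB).ne']
    exact Real.rpow_logb two_pos (by norm_num) hA0
  rw [hopt, hcoef]
  refine ⟨fun ℓ _ => ?_, by ring⟩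
  have htangent := mul_le_mul_of_nonneg_left (two_rpow_tangent_le hA0 (ℓ / (τ * B)))
    (show 0 ≤ ω * τ * B / (A * Real.log 2) by positivity)
  have hslope : ω * τ * B / (A * Real.log 2) *
      (A * (1 + Real.log 2 * (ℓ / (τ * B) - Real.logb 2 A))) =
      ω * τ * B / (A * Real.log 2) * A + ω * ℓ - ω * (τ * B * Real.logb 2 A) := by
    field_simp
    ring
  linarith
end

section
/- Let ω, μ, γ, C, τ, σ², B, h be positive real numbers with ω·B·h/(μ·σ²·ln 2) ≥ 1, and define F(ℓ₁, ℓ₂) = ω·(ℓ₁ + ℓ₂) − μ·(γ·C³·ℓ₁³/τ² + (σ²·τ/h)·(2^{ℓ₂/(τ·B)} − 1)) for ℓ₁, ℓ₂ ≥ 0. Then the supremum of F over [0,∞)² is attained at (ℓ₁*, ℓ₂*) = (√(ω·τ²/(3·μ·γ·C³)), τ·B·log₂(ω·B·h/(μ·σ²·ln 2))), and this maximizer is unique. -/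
/-- On the nonnegative reals, `w * x - a * x ^ 3` is uniquely maximized at its positive critical
point. -/
lemma linear_sub_cubic_lt_of_critical {a w s x : ℝ} (ha : 0 < a) (hs : 0 < s)
    (hw : w = 3 * a * s ^ 2) (hx : 0 ≤ x) (hxs : x ≠ s) :
    w * x - a * x ^ 3 < w * s - a * s ^ 3 := by
  have hgap : w * s - a * s ^ 3 - (w * x - a * x ^ 3) = a * ((x - s) ^ 2 * (x + 2 * s)) := by
    rw [hw]
    ring
  have hsq : 0 < (x - s) ^ 2 := by
    have := sub_ne_zero.mpr hxs
    positivity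
  have : 0 < a * ((x - s) ^ 2 * (x + 2 * s)) := by positivity
  linarith

/-- The function `w * y - b * (c ^ (y / T) - 1)` is uniquely maximized at its critical point. -/
lemma linear_sub_rpow_lt_of_critical {b c w y y₀ T : ℝ} (hb : 0 < b) (hc : 1 < c) (hT : 0 < T)
    (hw : w * T = b * Real.log c * c ^ (y₀ / T)) (hy : y ≠ y₀) :
    w * y - b * (c ^ (y / T) - 1) < w * y₀ - b * (c ^ (y₀ / T) - 1) := by
  have hc0 : 0 < c := zero_lt_one.trans hc
  have hlog : 0 < Real.log c := Real.log_pos hc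
  have hA : 0 < c ^ (y₀ / T) := Real.rpow_pos_of_pos hc0 _
  set u : ℝ := Real.log c * ((y - y₀) / T) with hu
  have hu0 : u ≠ 0 := mul_ne_zero hlog.ne' (div_ne_zero (sub_ne_zero.mpr hy) hT.ne')
  have hexp : c ^ (y / T) = c ^ (y₀ / T) * Real.exp u := by
    rw [hu, ← Real.rpow_def_of_pos hc0, ← Real.rpow_add hc0]
    congr 1
    ring
  have hlin : w * (y - y₀) = b * c ^ (y₀ / T) * u := by
    have hdiv : w = b * Real.log c * c ^ (y₀ / T) / T := eq_div_of_mul_eq hT.ne' hw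
    rw [hu, hdiv]
    ring
  have hlt := mul_lt_mul_of_pos_left (Real.add_one_lt_exp hu0) (mul_pos hb hA)
  rw [hexp]
  linarith

/-- The per-slot, per-user Lagrangian contribution
`F(ℓ₁, ℓ₂) = ω·(ℓ₁ + ℓ₂) − μ·(γ·C³·ℓ₁³/τ² + (σ²·τ/h)·(2^{ℓ₂/(τ·B)} − 1))`
attains its supremum over `[0,∞)²` at the pair of closed forms of
Proposition 1, and this maximizer is unique. -/
theorem joint_subproblem_unique_maximizer
    (ω μ γ C τ σ2 B h : ℝ) (hω : 0 < ω) (hμ : 0 < μ) (hγ : 0 < γ) (hC : 0 < C)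
    (hτ : 0 < τ) (hσ : 0 < σ2) (hB : 0 < B) (hh : 0 < h)
    (hA : 1 ≤ ω * B * h / (μ * σ2 * Real.log 2)) :
    (∀ ℓ₁ ℓ₂ : ℝ, 0 ≤ ℓ₁ → 0 ≤ ℓ₂ →
        ω * (ℓ₁ + ℓ₂) - μ * (γ * C ^ 3 * ℓ₁ ^ 3 / τ ^ 2
            + (σ2 * τ / h) * ((2 : ℝ) ^ (ℓ₂ / (τ * B)) - 1))
          ≤ ω * (Real.sqrt (ω * τ ^ 2 / (3 * μ * γ * C ^ 3))
                + τ * B * Real.logb 2 (ω * B * h / (μ * σ2 * Real.log 2)))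
            - μ * (γ * C ^ 3 * Real.sqrt (ω * τ ^ 2 / (3 * μ * γ * C ^ 3)) ^ 3 / τ ^ 2
                + (σ2 * τ / h) *
                  ((2 : ℝ) ^ (τ * B * Real.logb 2 (ω * B * h / (μ * σ2 * Real.log 2))
                      / (τ * B)) - 1)))
    ∧ (∀ ℓ₁ ℓ₂ : ℝ, 0 ≤ ℓ₁ → 0 ≤ ℓ₂ →
        ω * (ℓ₁ + ℓ₂) - μ * (γ * C ^ 3 * ℓ₁ ^ 3 / τ ^ 2
            + (σ2 * τ / h) * ((2 : ℝ) ^ (ℓ₂ / (τ * B)) - 1))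
          = ω * (Real.sqrt (ω * τ ^ 2 / (3 * μ * γ * C ^ 3))
                + τ * B * Real.logb 2 (ω * B * h / (μ * σ2 * Real.log 2)))
            - μ * (γ * C ^ 3 * Real.sqrt (ω * τ ^ 2 / (3 * μ * γ * C ^ 3)) ^ 3 / τ ^ 2
                + (σ2 * τ / h) *
                  ((2 : ℝ) ^ (τ * B * Real.logb 2 (ω * B * h / (μ * σ2 * Real.log 2))
                      / (τ * B)) - 1)) →
        ℓ₁ = Real.sqrt (ω * τ ^ 2 / (3 * μ * γ * C ^ 3))
          ∧ ℓ₂ = τ * B * Real.logb 2 (ω * B * h / (μ * σ2 * Real.log 2))) := by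
  have hlog2 : 0 < Real.log 2 := Real.log_pos one_lt_two
  set s := Real.sqrt (ω * τ ^ 2 / (3 * μ * γ * C ^ 3)) with hs_def
  set A := ω * B * h / (μ * σ2 * Real.log 2) with hA_def
  set y₀ := τ * B * Real.logb 2 A with hy₀
  have hs : 0 < s := Real.sqrt_pos.mpr (by positivity)
  have hs_critical : ω = 3 * (μ * γ * C ^ 3 / τ ^ 2) * s ^ 2 := by
    rw [hs_def, Real.sq_sqrt (by positivity)]
    field_simp
  have hT : 0 < τ * B := mul_pos hτ hB
  have hpow : (2 : ℝ) ^ (y₀ / (τ * B)) = A := by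
    rw [hy₀, mul_div_cancel_left₀ _ hT.ne']
    exact Real.rpow_logb two_pos (by norm_num) (zero_lt_one.trans_le hA)
  have hy₀_critical :
      ω * (τ * B) = μ * (σ2 * τ / h) * Real.log 2 * (2 : ℝ) ^ (y₀ / (τ * B)) := by
    rw [hpow, hA_def]
    field_simp
  have hsplit (x y : ℝ) :
      ω * (x + y) - μ * (γ * C ^ 3 * x ^ 3 / τ ^ 2 + σ2 * τ / h * ((2 : ℝ) ^ (y / (τ * B)) - 1))
        = (ω * x - μ * γ * C ^ 3 / τ ^ 2 * x ^ 3)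
          + (ω * y - μ * (σ2 * τ / h) * ((2 : ℝ) ^ (y / (τ * B)) - 1)) := by
    ring
  have hlocal_lt {x : ℝ} (hx : 0 ≤ x) (hne : x ≠ s) :=
    linear_sub_cubic_lt_of_critical (by positivity) hs hs_critical hx hne
  have hoff_lt {y : ℝ} (hne : y ≠ y₀) :=
    linear_sub_rpow_lt_of_critical (by positivity) one_lt_two hT hy₀_critical hne
  have hlocal {x : ℝ} (hx : 0 ≤ x) :
      ω * x - μ * γ * C ^ 3 / τ ^ 2 * x ^ 3 ≤ ω * s - μ * γ * C ^ 3 / τ ^ 2 * s ^ 3 := by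
    rcases eq_or_ne x s with h | h
    · rw [h]
    · exact (hlocal_lt hx h).le
  have hoff (y : ℝ) :
      ω * y - μ * (σ2 * τ / h) * ((2 : ℝ) ^ (y / (τ * B)) - 1)
        ≤ ω * y₀ - μ * (σ2 * τ / h) * ((2 : ℝ) ^ (y₀ / (τ * B)) - 1) := by
    rcases eq_or_ne y y₀ with h | h
    · rw [h]
    · exact (hoff_lt h).le
  simp only [hsplit]
  refine ⟨fun x y hx _ => add_le_add (hlocal hx) (hoff y), fun x y hx _ heq => ⟨?_, ?_⟩⟩
  · by_contra hne
    exact (add_lt_add_of_lt_of_le (hlocal_lt hx hne) (hoff y)).ne heq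
  · by_contra hne
    exact (add_lt_add_of_le_of_lt (hlocal hx) (hoff_lt hne)).ne heq
end
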